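/- arXiv:math/0603467 — 2 statements merged into one kernel-verified Lean document; each statement's English description precedes it below -/
import Mathlib

section
/- Let T = [[1,1],[0,1]] and B = [[1,0],[1,1]] in SL₂(ℤ). Suppose n, m ≥ 1 are integers, a₁, b₁, …, aₙ, bₙ and c₁, d₁, …, c_m, d_m are positive integers, and the products T^{a₁}·B^{b₁}·⋯·T^{aₙ}·B^{bₙ} and T^{c₁}·B^{d₁}·⋯·T^{c_m}·B^{d_m} are conjugate in SL₂(ℤ). Then m = n and the sequence of pairs ((c₁,d₁), (c₂,d₂), …, (cₙ,dₙ)) is a cyclic permutation of ((a₁,b₁), (a₂,b₂), …, (aₙ,bₙ)); that is, there exists k ∈ {0,1,…,n−1} such that cᵢ = a_{((i+k−1) mod n)+1} and dᵢ = b_{((i+k−1) mod n)+1} for all i ∈ {1,…,n}. -/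
/-- The matrix `T = [[1,1],[0,1]]` in `SL₂(ℤ)`. -/
noncomputable def Tmat : Matrix.SpecialLinearGroup (Fin 2) ℤ :=
  ⟨!![1, 1; 0, 1], by norm_num [Matrix.det_fin_two_of]⟩

/-- The matrix `B = [[1,0],[1,1]]` in `SL₂(ℤ)`. -/
noncomputable def Bmat : Matrix.SpecialLinearGroup (Fin 2) ℤ :=
  ⟨!![1, 0; 1, 1], by norm_num [Matrix.det_fin_two_of]⟩

namespace LRproof

abbrev SL := Matrix.SpecialLinearGroup (Fin 2) ℤ

lemma det_eq (A : SL) : A 0 0 * A 1 1 - A 0 1 * A 1 0 = 1 := by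
  have h := A.2
  rw [Matrix.det_fin_two] at h
  exact h

lemma mul_apply' (A B : SL) (i j : Fin 2) : (A * B) i j = A i 0 * B 0 j + A i 1 * B 1 j := by
  simp [Matrix.mul_apply, Fin.sum_univ_two]

lemma ext4 (A B : SL) (h1 : A 0 0 = B 0 0) (h2 : A 0 1 = B 0 1) (h3 : A 1 0 = B 1 0)
    (h4 : A 1 1 = B 1 1) : A = B := by
  ext i j
  fin_cases i <;> fin_cases j <;> assumption

@[simp] lemma T00 : Tmat 0 0 = 1 := rfl
@[simp] lemma T01 : Tmat 0 1 = 1 := rfl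
@[simp] lemma T10 : Tmat 1 0 = 0 := rfl
@[simp] lemma T11 : Tmat 1 1 = 1 := rfl
@[simp] lemma B00 : Bmat 0 0 = 1 := rfl
@[simp] lemma B01 : Bmat 0 1 = 0 := rfl
@[simp] lemma B10 : Bmat 1 0 = 1 := rfl
@[simp] lemma B11 : Bmat 1 1 = 1 := rfl
lemma I00 : (1 : SL) 0 0 = 1 := rfl
lemma I01 : (1 : SL) 0 1 = 0 := rfl
lemma I10 : (1 : SL) 1 0 = 0 := rfl
lemma I11 : (1 : SL) 1 1 = 1 := rfl

/-- letters: false is T, true is B -/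
noncomputable def letter (x : Bool) : SL := if x then Bmat else Tmat

noncomputable def ev (w : List Bool) : SL := (w.map letter).prod

lemma ev_nil : ev [] = 1 := rfl
lemma ev_cons (x : Bool) (w : List Bool) : ev (x :: w) = letter x * ev w := by simp [ev]
lemma ev_append (u w : List Bool) : ev (u ++ w) = ev u * ev w := by simp [ev]

def NN (A : SL) : Prop := 0 ≤ A 0 0 ∧ 0 ≤ A 0 1 ∧ 0 ≤ A 1 0 ∧ 0 ≤ A 1 1
def PP (A : SL) : Prop := 1 ≤ A 0 0 ∧ 1 ≤ A 0 1 ∧ 1 ≤ A 1 0 ∧ 1 ≤ A 1 1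

lemma NN.mul {A B : SL} (hA : NN A) (hB : NN B) : NN (A * B) := by
  obtain ⟨a, b, c, d⟩ := hA
  obtain ⟨a', b', c', d'⟩ := hB
  refine ⟨?_, ?_, ?_, ?_⟩ <;> rw [mul_apply'] <;> positivity

lemma PP.mul {A B : SL} (hA : PP A) (hB : PP B) : PP (A * B) := by
  obtain ⟨a, b, c, d⟩ := hA
  obtain ⟨a', b', c', d'⟩ := hB
  refine ⟨?_, ?_, ?_, ?_⟩ <;> rw [mul_apply'] <;> nlinarith

lemma NN_letter (x : Bool) : NN (letter x) := by
  cases x <;> simp [letter, NN]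

lemma NN_ev (w : List Bool) : NN (ev w) := by
  induction w with
  | nil => rw [ev_nil]; exact ⟨by decide, by decide, by decide, by decide⟩
  | cons x w ih => rw [ev_cons]; exact (NN_letter x).mul ih

/-- row dominance -/
def Dom (x : Bool) (A : SL) : Prop :=
  if x then A 0 0 ≤ A 1 0 ∧ A 0 1 ≤ A 1 1 else A 1 0 ≤ A 0 0 ∧ A 1 1 ≤ A 0 1

lemma Dom_letter_mul (x : Bool) {A : SL} (h : NN A) : Dom x (letter x * A) := by
  obtain ⟨a, b, c, d⟩ := h
  cases x <;> simp [Dom, letter, mul_apply'] <;> constructor <;> linarith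

lemma Dom_mul (x : Bool) {A B : SL} (h : Dom x A) (hB : NN B) : Dom x (A * B) := by
  obtain ⟨a, b, c, d⟩ := hB
  cases x <;> simp only [Dom, if_true, if_false, Bool.false_eq_true, mul_apply'] at h ⊢ <;>
    obtain ⟨h1, h2⟩ := h <;> constructor <;> nlinarith

lemma Dom_unique {x y : Bool} {A : SL} (h : Dom x A) (h' : Dom y A) : x = y := by
  have hd := det_eq A
  cases x <;> cases y <;> simp only [Dom, if_true, if_false, Bool.false_eq_true] at h h' ⊢ <;>
  · have e1 : A 0 0 = A 1 0 := by linarith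
    have e2 : A 0 1 = A 1 1 := by linarith
    rw [e1, e2] at hd
    exfalso; nlinarith

lemma Dom_one {x : Bool} : ¬ Dom x 1 := by
  cases x <;> simp [Dom]

lemma mk_exists (p q r s : ℤ) (h : p * s - q * r = 1) :
    ∃ A : SL, A 0 0 = p ∧ A 0 1 = q ∧ A 1 0 = r ∧ A 1 1 = s :=
  ⟨⟨!![p, q; r, s], by rw [Matrix.det_fin_two_of]; exact h⟩, rfl, rfl, rfl, rfl⟩

lemma Dom_peel {x : Bool} {A : SL} (hA : NN A) (h : Dom x A) :
    ∃ A', NN A' ∧ A = letter x * A' := by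
  obtain ⟨a, b, c, d⟩ := hA
  have hd := det_eq A
  cases x <;> simp only [Dom, if_true, if_false, Bool.false_eq_true] at h
  · obtain ⟨A', e1, e2, e3, e4⟩ :=
      mk_exists (A 0 0 - A 1 0) (A 0 1 - A 1 1) (A 1 0) (A 1 1) (by linarith)
    refine ⟨A', ⟨by linarith, by linarith, by linarith, by linarith⟩, ?_⟩
    apply ext4 <;> rw [mul_apply'] <;> simp [letter, e1, e2, e3, e4]
  · obtain ⟨A', e1, e2, e3, e4⟩ :=
      mk_exists (A 0 0) (A 0 1) (A 1 0 - A 0 0) (A 1 1 - A 0 1) (by linarith)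
    refine ⟨A', ⟨by linarith, by linarith, by linarith, by linarith⟩, ?_⟩
    apply ext4 <;> rw [mul_apply'] <;> simp [letter, e1, e2, e3, e4]

lemma Dom_exists {A : SL} (hA : NN A) : A = 1 ∨ ∃ x, Dom x A := by
  obtain ⟨a, b, c, d⟩ := hA
  have hd := det_eq A
  by_cases h1 : A 1 0 ≤ A 0 0 ∧ A 1 1 ≤ A 0 1
  · exact Or.inr ⟨false, by simpa [Dom] using h1⟩
  by_cases h2 : A 0 0 ≤ A 1 0 ∧ A 0 1 ≤ A 1 1
  · exact Or.inr ⟨true, by simpa [Dom] using h2⟩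
  left
  have h3 : A 1 0 < A 0 0 ∧ A 0 1 < A 1 1 := by
    by_contra hcon
    have : A 0 0 < A 1 0 ∧ A 1 1 < A 0 1 := by omega
    nlinarith
  have h4 : (A 1 0 + 1) * (A 0 1 + 1) ≤ A 0 0 * A 1 1 := by
    apply mul_le_mul <;> omega
  have e1 : A 1 0 = 0 := by nlinarith
  have e2 : A 0 1 = 0 := by nlinarith
  rw [e1, e2] at hd
  have e3 : A 0 0 = 1 := by nlinarith
  have e4 : A 1 1 = 1 := by nlinarith
  exact ext4 _ _ e3 e2 e1 e4

/-- entry sum -/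
def sm (A : SL) : ℤ := A 0 0 + A 0 1 + A 1 0 + A 1 1

lemma sm_lt (x : Bool) {A : SL} (h : NN A) : sm A < sm (letter x * A) := by
  obtain ⟨a, b, c, d⟩ := h
  have hd := det_eq A
  have p0 : 0 < A 0 0 + A 0 1 := by
    by_contra hc
    have e1 : A 0 0 = 0 := by linarith
    have e2 : A 0 1 = 0 := by linarith
    rw [e1, e2] at hd; simp at hd
  have p1 : 0 < A 1 0 + A 1 1 := by
    by_contra hc
    have e1 : A 1 0 = 0 := by linarith
    have e2 : A 1 1 = 0 := by linarith
    rw [e1, e2] at hd; simp at hd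
  cases x <;> simp [sm, letter, mul_apply'] <;> linarith

lemma ev_inj (u w : List Bool) (h : ev u = ev w) : u = w := by
  induction u generalizing w with
  | nil =>
    cases w with
    | nil => rfl
    | cons y w =>
      exfalso
      rw [ev_nil, ev_cons] at h
      have := Dom_letter_mul y (NN_ev w)
      rw [← h] at this
      exact Dom_one this
  | cons x u ih =>
    cases w with
    | nil =>
      exfalso
      rw [ev_nil, ev_cons] at h
      have := Dom_letter_mul x (NN_ev u)
      rw [h] at this
      exact Dom_one this
    | cons y w =>
      rw [ev_cons, ev_cons] at h
      have h1 := Dom_letter_mul x (NN_ev u)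
      have h2 := Dom_letter_mul y (NN_ev w)
      rw [h] at h1
      obtain rfl := Dom_unique h1 h2
      rw [ih w (mul_left_cancel h)]

lemma conj_NN (N : ℕ) : ∀ (P : SL) (u w : List Bool), NN P → (sm P).toNat ≤ N →
    P * ev u = ev w * P → w ~r u := by
  induction N with
  | zero =>
    intro P u w hP hs h
    exfalso
    obtain ⟨a, b, c, d⟩ := hP
    have hd := det_eq P
    unfold sm at hs
    have : P 0 0 = 0 := by omega
    have : P 0 1 = 0 := by omega
    simp_all
  | succ N ih =>
    intro P u w hP hs h
    rcases Dom_exists hP with rfl | ⟨x, hx⟩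
    · rw [one_mul, mul_one] at h
      rw [ev_inj _ _ h]
    · cases w with
      | nil =>
        rw [ev_nil, one_mul] at h
        have : ev u = ev [] := by rw [ev_nil]; exact mul_eq_left.1 h
        rw [ev_inj _ _ this]
      | cons y w =>
        have h1 := Dom_mul x hx (NN_ev u)
        have h2 := Dom_letter_mul y ((NN_ev w).mul hP)
        rw [← mul_assoc, ← ev_cons, ← h] at h2
        obtain rfl := Dom_unique h1 h2
        obtain ⟨P', hP', rfl⟩ := Dom_peel hP hx
        have hlt := sm_lt x hP'
        have h3 : P' * ev u = ev (w ++ [x]) * P' := by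
          rw [ev_cons, mul_assoc, mul_assoc] at h
          rw [mul_left_cancel h, ev_append, ev_cons, ev_nil, mul_one, mul_assoc]
        have := ih P' u (w ++ [x]) hP' (by omega) h3
        refine List.IsRotated.trans ⟨1, by simp⟩ this

/-- definite sign -/
def Df (x y : ℤ) : Prop := (0 ≤ x ∧ 0 ≤ y) ∨ (x ≤ 0 ∧ y ≤ 0)

lemma Df_step {a b c d : ℤ} (ha : 1 ≤ a) (hb : 1 ≤ b) (hc : 1 ≤ c) (hd : 1 ≤ d) {x y : ℤ}
    (h : Df x y) : Df (a * x + b * y) (c * x + d * y) := by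
  rcases h with ⟨h1, h2⟩ | ⟨h1, h2⟩
  · left; constructor <;> positivity
  · right; constructor <;> nlinarith

lemma Df_lt {a b c d : ℤ} (ha : 1 ≤ a) (hb : 1 ≤ b) (hc : 1 ≤ c) (hd : 1 ≤ d)
    (hdet : a * d - b * c = 1) {x y : ℤ} (h : ¬ Df (a * x + b * y) (c * x + d * y)) :
    |a * x + b * y| + |c * x + d * y| < |x| + |y| := by
  obtain ⟨X, hX⟩ : ∃ X, X = a * x + b * y := ⟨_, rfl⟩
  obtain ⟨Y, hY⟩ : ∃ Y, Y = c * x + d * y := ⟨_, rfl⟩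
  have e1 : x = d * X - b * Y := by subst hX hY; linear_combination (-x) * hdet
  have e2 : y = a * Y - c * X := by subst hX hY; linear_combination (-y) * hdet
  rw [← hX, ← hY] at h ⊢
  have : (0 < X ∧ Y < 0) ∨ (X < 0 ∧ 0 < Y) := by unfold Df at h; omega
  rcases this with ⟨h1, h2⟩ | ⟨h1, h2⟩
  · rw [abs_of_pos h1, abs_of_neg h2]
    have := le_abs_self x
    have := neg_le_abs y
    nlinarith
  · rw [abs_of_neg h1, abs_of_pos h2]
    have := le_abs_self y
    have := neg_le_abs x
    nlinarith

lemma Df_col_mul {M A : SL} (hM : PP M) (j : Fin 2) (h : Df (A 0 j) (A 1 j)) :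
    Df ((M * A) 0 j) ((M * A) 1 j) := by
  obtain ⟨a, b, c, d⟩ := hM
  rw [mul_apply', mul_apply']
  exact Df_step a b c d h

lemma Df_row_mul {M A : SL} (hM : PP M) (i : Fin 2) (h : Df (A i 0) (A i 1)) :
    Df ((A * M) i 0) ((A * M) i 1) := by
  obtain ⟨a, b, c, d⟩ := hM
  rw [mul_apply', mul_apply']
  have := Df_step a c b d h
  simpa only [mul_comm] using this

lemma Df_col_pow {M : SL} (hM : PP M) (j : Fin 2) (k : ℕ) {A : SL} (h : Df (A 0 j) (A 1 j)) :
    Df ((M ^ k * A) 0 j) ((M ^ k * A) 1 j) := by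
  induction k with
  | zero => simpa using h
  | succ k ih => rw [pow_succ', mul_assoc]; exact Df_col_mul hM j ih

lemma Df_row_pow {M : SL} (hM : PP M) (j : Fin 2) (k : ℕ) {A : SL} (h : Df (A j 0) (A j 1)) :
    Df ((A * M ^ k) j 0) ((A * M ^ k) j 1) := by
  induction k with
  | zero => simpa using h
  | succ k ih => rw [pow_succ, ← mul_assoc]; exact Df_row_mul hM j ih

lemma col_exists {M : SL} (hM : PP M) (j : Fin 2) (N : ℕ) : ∀ (A : SL),
    |A 0 j| + |A 1 j| ≤ N → ∃ k : ℕ, Df ((M ^ k * A) 0 j) ((M ^ k * A) 1 j) := by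
  induction N with
  | zero =>
    intro A h
    refine ⟨0, ?_⟩
    have h1 := abs_nonneg (A 0 j)
    have h2 := abs_nonneg (A 1 j)
    have e1 : A 0 j = 0 := by rw [← abs_eq_zero]; push_cast at h; linarith
    have e2 : A 1 j = 0 := by rw [← abs_eq_zero]; push_cast at h; linarith
    rw [pow_zero, one_mul, e1, e2]
    simp [Df]
  | succ N ih =>
    intro A h
    by_cases hD : Df ((M * A) 0 j) ((M * A) 1 j)
    · exact ⟨1, by simpa using hD⟩
    · have hlt : |(M * A) 0 j| + |(M * A) 1 j| < |A 0 j| + |A 1 j| := by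
        obtain ⟨a, b, c, d⟩ := hM
        rw [mul_apply', mul_apply'] at hD ⊢
        exact Df_lt a b c d (det_eq M) hD
      obtain ⟨k, hk⟩ := ih (M * A) (by push_cast at h; linarith)
      exact ⟨k + 1, by rw [pow_succ, mul_assoc]; exact hk⟩

lemma row_exists {M : SL} (hM : PP M) (j : Fin 2) (N : ℕ) : ∀ (A : SL),
    |A j 0| + |A j 1| ≤ N → ∃ k : ℕ, Df ((A * M ^ k) j 0) ((A * M ^ k) j 1) := by
  induction N with
  | zero =>
    intro A h
    refine ⟨0, ?_⟩
    have h1 := abs_nonneg (A j 0)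
    have h2 := abs_nonneg (A j 1)
    have e1 : A j 0 = 0 := by rw [← abs_eq_zero]; push_cast at h; linarith
    have e2 : A j 1 = 0 := by rw [← abs_eq_zero]; push_cast at h; linarith
    rw [pow_zero, mul_one, e1, e2]
    simp [Df]
  | succ N ih =>
    intro A h
    by_cases hD : Df ((A * M) j 0) ((A * M) j 1)
    · exact ⟨1, by simpa using hD⟩
    · have hlt : |(A * M) j 0| + |(A * M) j 1| < |A j 0| + |A j 1| := by
        obtain ⟨a, b, c, d⟩ := hM
        rw [mul_apply', mul_apply'] at hD ⊢
        have e := det_eq M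
        have := Df_lt a c b d (x := A j 0) (y := A j 1) (by linarith)
          (by simpa only [mul_comm] using hD)
        simpa only [mul_comm] using this
      obtain ⟨k, hk⟩ := ih (A * M) (by push_cast at h; linarith)
      exact ⟨k + 1, by rw [pow_succ', ← mul_assoc]; exact hk⟩

lemma pow_comm' {M M' P : SL} (h : P * M = M' * P) (k : ℕ) : P * M ^ k = M' ^ k * P := by
  induction k with
  | zero => simp
  | succ k ih => rw [pow_succ, ← mul_assoc, ih, mul_assoc, h, ← mul_assoc, ← pow_succ]

lemma sign_cases {p q r s : ℤ} (h0 : (0 ≤ p ∧ 0 ≤ r) ∨ (p ≤ 0 ∧ r ≤ 0))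
    (h1 : (0 ≤ q ∧ 0 ≤ s) ∨ (q ≤ 0 ∧ s ≤ 0)) (h2 : (0 ≤ p ∧ 0 ≤ q) ∨ (p ≤ 0 ∧ q ≤ 0))
    (h3 : (0 ≤ r ∧ 0 ≤ s) ∨ (r ≤ 0 ∧ s ≤ 0))
    (hcon : ¬ ((0 ≤ p ∧ 0 ≤ q ∧ 0 ≤ r ∧ 0 ≤ s) ∨ (0 ≤ -p ∧ 0 ≤ -q ∧ 0 ≤ -r ∧ 0 ≤ -s))) :
    (p = 0 ∧ s = 0 ∧ 0 < q ∧ r < 0) ∨ (p = 0 ∧ s = 0 ∧ q < 0 ∧ 0 < r) ∨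
    (q = 0 ∧ r = 0 ∧ 0 < p ∧ s < 0) ∨ (q = 0 ∧ r = 0 ∧ p < 0 ∧ 0 < s) := by
  rcases h0 with h0 | h0 <;> rcases h1 with h1 | h1 <;> rcases h2 with h2 | h2 <;>
    rcases h3 with h3 | h3 <;> omega

lemma exists_definite {M M' P : SL} (hM : PP M) (hM' : PP M') (h : P * M = M' * P) :
    ∃ Q : SL, Q * M = M' * Q ∧ (NN Q ∨ NN (-Q)) := by
  obtain ⟨k0, h0⟩ := col_exists hM' 0 _ P (Int.self_le_toNat _)
  obtain ⟨k1, h1⟩ := col_exists hM' 1 _ P (Int.self_le_toNat _)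
  obtain ⟨k2, h2⟩ := row_exists hM 0 _ P (Int.self_le_toNat _)
  obtain ⟨k3, h3⟩ := row_exists hM 1 _ P (Int.self_le_toNat _)
  have h0' := Df_col_pow hM' 0 (k1 + k2 + k3) h0
  have h1' := Df_col_pow hM' 1 (k0 + k2 + k3) h1
  have h2' := Df_row_pow hM 0 (k0 + k1 + k3) h2
  have h3' := Df_row_pow hM 1 (k0 + k1 + k2) h3
  rw [← mul_assoc, ← pow_add] at h0' h1'
  rw [mul_assoc, ← pow_add, pow_comm' h] at h2' h3'
  rw [show k1 + k2 + k3 + k0 = k0 + k1 + k2 + k3 by ring] at h0'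
  rw [show k0 + k2 + k3 + k1 = k0 + k1 + k2 + k3 by ring] at h1'
  rw [show k2 + (k0 + k1 + k3) = k0 + k1 + k2 + k3 by ring] at h2'
  rw [show k3 + (k0 + k1 + k2) = k0 + k1 + k2 + k3 by ring] at h3'
  have hQ : M' ^ (k0 + k1 + k2 + k3) * P * M = M' * (M' ^ (k0 + k1 + k2 + k3) * P) := by
    rw [mul_assoc, h, ← mul_assoc, ← pow_succ, ← mul_assoc, ← pow_succ']
  generalize M' ^ (k0 + k1 + k2 + k3) * P = Q at *
  refine ⟨Q, hQ, ?_⟩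
  have hd := det_eq Q
  have e00 : (Q * M) 0 0 = (M' * Q) 0 0 := by rw [hQ]
  have e01 : (Q * M) 0 1 = (M' * Q) 0 1 := by rw [hQ]
  have e10 : (Q * M) 1 0 = (M' * Q) 1 0 := by rw [hQ]
  have e11 : (Q * M) 1 1 = (M' * Q) 1 1 := by rw [hQ]
  rw [mul_apply', mul_apply'] at e00 e01 e10 e11
  have n00 : (-Q) 0 0 = - Q 0 0 := rfl
  have n01 : (-Q) 0 1 = - Q 0 1 := rfl
  have n10 : (-Q) 1 0 = - Q 1 0 := rfl
  have n11 : (-Q) 1 1 = - Q 1 1 := rfl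
  obtain ⟨a, b, c, d⟩ := hM
  obtain ⟨a', b', c', d'⟩ := hM'
  unfold NN
  rw [n00, n01, n10, n11]
  unfold Df at *
  generalize Q 0 0 = p at *
  generalize Q 0 1 = q at *
  generalize Q 1 0 = r at *
  generalize Q 1 1 = s at *
  by_contra hcon
  have hc1 : (p = 0 ∧ s = 0 ∧ 0 < q ∧ r < 0) ∨ (p = 0 ∧ s = 0 ∧ q < 0 ∧ 0 < r) ∨
    (q = 0 ∧ r = 0 ∧ 0 < p ∧ s < 0) ∨ (q = 0 ∧ r = 0 ∧ p < 0 ∧ 0 < s) := sign_cases h0' h1' h2' h3' hcon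
  rcases hc1 with ⟨rfl, rfl, h5, h6⟩ | ⟨rfl, rfl, h5, h6⟩ | ⟨rfl, rfl, h5, h6⟩ | ⟨rfl, rfl, h5, h6⟩
  · nlinarith
  · nlinarith
  · nlinarith
  · nlinarith

lemma conj_words (u w : List Bool) (hu : PP (ev u)) (hw : PP (ev w)) (h : IsConj (ev u) (ev w)) :
    w ~r u := by
  obtain ⟨P, hP⟩ := isConj_iff.1 h
  have hP' : P * ev u = ev w * P := by rw [← hP]; group
  obtain ⟨Q, hQ, hN | hN⟩ := exists_definite hu hw hP'
  · exact conj_NN _ Q u w hN le_rfl hQ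
  · exact conj_NN _ (-Q) u w hN le_rfl (by rw [neg_mul, mul_neg, hQ])

/-- word of a list of pairs -/
def wd (L : List (ℕ × ℕ)) : List Bool :=
  L.flatMap fun p => List.replicate p.1 false ++ List.replicate p.2 true

lemma wd_cons (p : ℕ × ℕ) (L : List (ℕ × ℕ)) :
    wd (p :: L) = List.replicate p.1 false ++ (List.replicate p.2 true ++ wd L) := by simp [wd]

def Good (L : List (ℕ × ℕ)) : Prop := ∀ p ∈ L, 0 < p.1 ∧ 0 < p.2

lemma ev_rep (x : Bool) (k : ℕ) : ev (List.replicate k x) = letter x ^ k := by simp [ev]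

lemma ev_wd (L : List (ℕ × ℕ)) : ev (wd L) = (L.map fun p => Tmat ^ p.1 * Bmat ^ p.2).prod := by
  induction L with
  | nil => rfl
  | cons p L ih =>
    rw [wd_cons, ev_append, ev_append, ev_rep, ev_rep, ih]
    simp [letter, mul_assoc]

lemma T_pow (k : ℕ) : (Tmat ^ k) 0 0 = 1 ∧ (Tmat ^ k) 0 1 = k ∧ (Tmat ^ k) 1 0 = 0 ∧
    (Tmat ^ k) 1 1 = 1 := by
  induction k with
  | zero => simp
  | succ k ih =>
    obtain ⟨a, b, c, d⟩ := ih
    rw [pow_succ]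
    simp only [mul_apply', a, b, c, d]
    simp [add_comm]

lemma B_pow (k : ℕ) : (Bmat ^ k) 0 0 = 1 ∧ (Bmat ^ k) 0 1 = 0 ∧ (Bmat ^ k) 1 0 = k ∧
    (Bmat ^ k) 1 1 = 1 := by
  induction k with
  | zero => simp
  | succ k ih =>
    obtain ⟨a, b, c, d⟩ := ih
    rw [pow_succ]
    simp only [mul_apply', a, b, c, d]
    simp

lemma PP_block {a b : ℕ} (ha : 0 < a) (hb : 0 < b) : PP (Tmat ^ a * Bmat ^ b) := by
  obtain ⟨p, q, r, s⟩ := T_pow a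
  obtain ⟨p', q', r', s'⟩ := B_pow b
  simp only [PP, mul_apply', p, q, r, s, p', q', r', s']
  have ha' : (1 : ℤ) ≤ a := by exact_mod_cast ha
  have hb' : (1 : ℤ) ≤ b := by exact_mod_cast hb
  refine ⟨?_, ?_, ?_, ?_⟩ <;> nlinarith

lemma PP_wd {L : List (ℕ × ℕ)} (hL : Good L) (hne : L ≠ []) : PP (ev (wd L)) := by
  rw [ev_wd]
  induction L with
  | nil => exact absurd rfl hne
  | cons p L ih =>
    have hp := hL p (by simp)
    have h1 := PP_block hp.1 hp.2
    rw [List.map_cons, List.prod_cons]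
    by_cases hL' : L = []
    · subst hL'; simpa using h1
    · exact h1.mul (ih (fun q hq => hL q (by simp [hq])) hL')

lemma rep_inj (x : Bool) (a c : ℕ) (U V : List Bool) (hU : U.head? ≠ some x)
    (hV : V.head? ≠ some x) (h : List.replicate a x ++ U = List.replicate c x ++ V) :
    a = c ∧ U = V := by
  induction a generalizing c with
  | zero =>
    cases c with
    | zero => simpa using h
    | succ c => exfalso; apply hU; simp [List.replicate_succ] at h; simp [h]
  | succ a ih =>
    cases c with
    | zero => exfalso; apply hV; simp [List.replicate_succ] at h; simp [← h]
    | succ c =>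
      simp only [List.replicate_succ, List.cons_append, List.cons.injEq, true_and] at h
      obtain ⟨h1, h2⟩ := ih c h
      exact ⟨by rw [h1], h2⟩

lemma head_wd {L : List (ℕ × ℕ)} (hL : Good L) : L ≠ [] → (wd L).head? = some false := by
  intro h
  cases L with
  | nil => exact absurd rfl h
  | cons p L =>
    have := (hL p (by simp)).1
    obtain ⟨k, hk⟩ := Nat.exists_eq_succ_of_ne_zero this.ne'
    rw [wd_cons, hk]; rfl

lemma head_wd' {L : List (ℕ × ℕ)} (hL : Good L) : (wd L).head? ≠ some true := by
  by_cases h : L = []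
  · subst h; simp [wd]
  · rw [head_wd hL h]; simp

lemma last_wd {L : List (ℕ × ℕ)} (hL : Good L) : L ≠ [] → (wd L).getLast? = some true := by
  intro h
  obtain ⟨L', p, rfl⟩ := List.eq_nil_or_concat L |>.resolve_left h
  have := (hL p (by simp)).2
  obtain ⟨k, hk⟩ := Nat.exists_eq_succ_of_ne_zero this.ne'
  have e : wd (L' ++ [p]) = (wd L' ++ List.replicate p.1 false ++ List.replicate k true) ++ [true] := by
    simp [wd, hk, List.replicate_succ']
  rw [List.concat_eq_append, e, List.getLast?_concat]

lemma wd_inj {L L' : List (ℕ × ℕ)} (hL : Good L) (hL' : Good L') (h : wd L = wd L') : L = L' := by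
  induction L generalizing L' with
  | nil =>
    by_contra hne
    have := head_wd hL' (Ne.symm hne)
    rw [← h] at this
    simp [wd] at this
  | cons p L ih =>
    cases L' with
    | nil =>
      have := head_wd hL (by simp)
      rw [h] at this
      simp [wd] at this
    | cons q L' =>
      have hp := hL p (by simp)
      have hq := hL' q (by simp)
      have g : Good L := fun r hr => hL r (by simp [hr])
      have g' : Good L' := fun r hr => hL' r (by simp [hr])
      rw [wd_cons, wd_cons] at h
      have key : ∀ (k : ℕ) (W : List Bool), 0 < k →
          (List.replicate k true ++ W).head? ≠ some false := by
        intro k W hk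
        obtain ⟨k, rfl⟩ := Nat.exists_eq_succ_of_ne_zero hk.ne'
        simp [List.replicate_succ]
      obtain ⟨e1, h⟩ := rep_inj _ _ _ _ _ (key _ _ hp.2) (key _ _ hq.2) h
      obtain ⟨e2, h⟩ := rep_inj _ _ _ _ _ (head_wd' g) (head_wd' g') h
      rw [ih g g' h, Prod.ext e1 e2]

lemma split_wd {L : List (ℕ × ℕ)} (hL : Good L) (X Y : List Bool) (h : wd L = X ++ Y)
    (hX : X.getLast? = some true) (hY : Y.head? = some false) :
    ∃ L1 L2, L = L1 ++ L2 ∧ wd L1 = X ∧ wd L2 = Y := by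
  induction L generalizing X with
  | nil =>
    have : X = [] := by simp [wd] at h; exact h.1
    simp [this] at hX
  | cons p L ih =>
    have g : Good L := fun r hr => hL r (by simp [hr])
    rw [wd_cons, ← List.append_assoc] at h
    have e0 : wd [p] = List.replicate p.1 false ++ List.replicate p.2 true := by simp [wd]
    rw [List.append_eq_append_iff] at h
    rcases h with ⟨X', h1, h2⟩ | ⟨Y', h1, h2⟩
    · by_cases hX' : X' = []
      · subst hX'
        exact ⟨[p], L, rfl, by rw [e0, h1, List.append_nil], by simpa using h2⟩
      · have : X'.getLast? = some true := by
          rw [h1, List.getLast?_append_of_ne_nil _ hX'] at hX; exact hX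
        obtain ⟨L1, L2, rfl, i1, i2⟩ := ih g X' h2 this
        refine ⟨p :: L1, L2, rfl, ?_, i2⟩
        rw [wd_cons, i1, h1, List.append_assoc]
    · by_cases hY' : Y' = []
      · subst hY'
        refine ⟨[p], L, rfl, ?_, by simpa using h2.symm⟩
        rw [e0, h1, List.append_nil]
      · exfalso
        have m1 : true ∈ X := List.mem_of_getLast? hX
        have m2 : false ∈ Y' := by
          cases Y' with
          | nil => exact absurd rfl hY'
          | cons y Y' => rw [h2] at hY; simp at hY; simp [hY]
        have hs : (List.replicate p.1 false ++ List.replicate p.2 true).Pairwise (· ≤ ·) := by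
          rw [List.pairwise_append]
          refine ⟨by simp [List.pairwise_replicate], by simp [List.pairwise_replicate], ?_⟩
          intro a ha b hb
          rw [List.eq_of_mem_replicate ha]
          exact Bool.false_le b
        rw [h1, List.pairwise_append] at hs
        have := hs.2.2 _ m1 _ m2
        exact absurd this (by decide)

lemma rot_wd {L L' : List (ℕ × ℕ)} (hL : Good L) (hL' : Good L') (hne : L ≠ []) (hne' : L' ≠ [])
    (hrot : wd L ~r wd L') : L ~r L' := by
  obtain ⟨k, hk, h⟩ := List.isRotated_iff_mod.1 hrot
  clear hrot
  rw [List.rotate_eq_drop_append_take hk] at h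
  have h0 := (List.take_append_drop k (wd L)).symm
  generalize (wd L).take k = X at *
  generalize (wd L).drop k = Y at *
  by_cases hX : X = []
  · subst hX
    rw [wd_inj hL hL' (by simpa using h0.trans (by simpa using h))]
  by_cases hY : Y = []
  · subst hY
    rw [wd_inj hL hL' (by simpa using h0.trans (by simpa using h))]
  have a1 := head_wd hL' hne'
  rw [← h, List.head?_append_of_ne_nil _ hY] at a1
  have a2 := last_wd hL' hne'
  rw [← h, List.getLast?_append_of_ne_nil _ hX] at a2
  obtain ⟨L1, L2, rfl, i1, i2⟩ := split_wd hL X Y h0 a2 a1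
  have : L2 ++ L1 = L' := by
    apply wd_inj _ hL'
    · rw [← h, ← i1, ← i2]; simp [wd]
    · intro p hp
      apply hL p
      simp only [List.mem_append] at hp ⊢
      tauto
  rw [← this]
  exact List.isRotated_append

end LRproof

/-- Uniqueness, up to cyclic permutation of the factors, of the decomposition of a
hyperbolic element of `SL₂(ℤ)` as a product `T^{a₁} B^{b₁} ⋯ T^{aₙ} B^{bₙ}` with all
exponents positive. -/
theorem stmt1 (n m : ℕ) (hn : 1 ≤ n) (hm : 1 ≤ m)
    (a b : Fin n → ℕ) (c d : Fin m → ℕ)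
    (ha : ∀ i, 0 < a i) (hb : ∀ i, 0 < b i) (hc : ∀ i, 0 < c i) (hd : ∀ i, 0 < d i)
    (hconj : IsConj ((List.ofFn fun i : Fin n => Tmat ^ a i * Bmat ^ b i).prod)
      ((List.ofFn fun i : Fin m => Tmat ^ c i * Bmat ^ d i).prod)) :
    ∃ hmn : m = n, ∃ k : Fin n, ∀ i : Fin n,
      c (Fin.cast hmn.symm i) = a (i + k) ∧ d (Fin.cast hmn.symm i) = b (i + k) := by
  have gL : LRproof.Good (List.ofFn fun i : Fin n => (a i, b i)) := by
    intro p hp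
    obtain ⟨i, rfl⟩ := (List.mem_ofFn' _ _).1 hp
    exact ⟨ha i, hb i⟩
  have gL' : LRproof.Good (List.ofFn fun i : Fin m => (c i, d i)) := by
    intro p hp
    obtain ⟨i, rfl⟩ := (List.mem_ofFn' _ _).1 hp
    exact ⟨hc i, hd i⟩
  have nL : (List.ofFn fun i : Fin n => (a i, b i)) ≠ [] := by
    intro h; have := congrArg List.length h; simp at this; omega
  have nL' : (List.ofFn fun i : Fin m => (c i, d i)) ≠ [] := by
    intro h; have := congrArg List.length h; simp at this; omega
  have e1 := LRproof.ev_wd (List.ofFn fun i : Fin n => (a i, b i))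
  have e2 := LRproof.ev_wd (List.ofFn fun i : Fin m => (c i, d i))
  rw [List.map_ofFn] at e1 e2
  have hc' : IsConj (LRproof.ev (LRproof.wd (List.ofFn fun i : Fin n => (a i, b i))))
      (LRproof.ev (LRproof.wd (List.ofFn fun i : Fin m => (c i, d i)))) := by
    rw [e1, e2]; exact hconj
  have hr := LRproof.conj_words _ _ (LRproof.PP_wd gL nL) (LRproof.PP_wd gL' nL') hc'
  obtain ⟨k, hk⟩ := LRproof.rot_wd gL gL' nL nL' hr.symm
  have hlen := congrArg List.length hk
  simp at hlen
  subst hlen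
  refine ⟨rfl, ⟨k % n, Nat.mod_lt _ hn⟩, fun i => ?_⟩
  have hi : ((List.ofFn fun i : Fin n => (a i, b i)).rotate k)[(i : ℕ)]? =
      (List.ofFn fun i : Fin n => (c i, d i))[(i : ℕ)]? := by rw [hk]
  rw [List.getElem?_eq_getElem (by simp), List.getElem?_eq_getElem (by simp)] at hi
  rw [List.getElem_rotate] at hi
  simp only [List.getElem_ofFn, List.length_ofFn, Option.some.injEq, Prod.mk.injEq] at hi
  have e : i + ⟨k % n, Nat.mod_lt _ hn⟩ = (⟨(i + k) % n, Nat.mod_lt _ hn⟩ : Fin n) := by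
    apply Fin.ext
    simp [Fin.val_add]
  rw [e]
  exact ⟨hi.1.symm, hi.2.symm⟩
end

section
/- With N, q, the matrices M_U, M_V, M_W, and the matrix C_L = G·C̃_L as in the context, suppose u, v, h, u″, v″ are nonzero complex numbers with v^N ≠ −1, (u″)^N = u^N / (1 + v^{−N})², and (v″)^N = h^N·(1 + v^N)² / (u^N·v^N). Then the following three matrix identities hold: (a) M_U(u)·C_L = (1 + q·M_V(v)⁻¹)·(1 + q³·M_V(v)⁻¹)·C_L·M_U(u″); (b) (1 + q·M_V(v))·(1 + q³·M_V(v))·M_W(u,v,h)·C_L = C_L·M_V(v″); (c) M_V(v)·C_L·M_W(u″,v″,h) = C_L. -/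
open Matrix

/-- The image of the generator `U` of the Chekhov–Fock algebra of the once-punctured torus
under the standard representation: the diagonal matrix with entries `u·q^{4i}`. -/
noncomputable def MU (N : ℕ) (q u : ℂ) : Matrix (Fin N) (Fin N) ℂ :=
  Matrix.diagonal fun i => u * q ^ (4 * (i : ℕ))

/-- The image of the generator `V`: the cyclic shift matrix with entries `v`. -/
noncomputable def MV (N : ℕ) (v : ℂ) : Matrix (Fin N) (Fin N) ℂ :=
  Matrix.of fun i j => if (j : ℕ) = ((i : ℕ) + 1) % N then v else 0

/-- The image of the generator `W`: `q⁻²·h·(M_U(u)·M_V(v))⁻¹`. -/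
noncomputable def MW (N : ℕ) (q u v h : ℂ) : Matrix (Fin N) (Fin N) ℂ :=
  ((q ^ 2)⁻¹ * h) • (MU N q u * MV N v)⁻¹

/-- The matrix `G` with `(i,j)`-entry `q^{4ij}`. -/
noncomputable def Gmat (N : ℕ) (q : ℂ) : Matrix (Fin N) (Fin N) ℂ :=
  Matrix.of fun i j => q ^ (4 * (i : ℕ) * (j : ℕ))

/-- The matrix `C̃_L(u,v,u″,v″,h)` with `(i,j)`-entry
`q^{2(j−i)²+2i²}·(u″v″/(vh))^{j−i}·(uvv″/h)^i·∏_{α=1}^{i}[(1+q^{4α−3}v)(1+q^{4α−1}v)]⁻¹`. -/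
noncomputable def CLtilde (N : ℕ) (q u v u'' v'' h : ℂ) : Matrix (Fin N) (Fin N) ℂ :=
  Matrix.of fun i j =>
    q ^ (2 * ((j : ℤ) - (i : ℤ)) ^ 2 + 2 * (i : ℤ) ^ 2) *
      (u'' * v'' / (v * h)) ^ ((j : ℤ) - (i : ℤ)) *
      (u * v * v'' / h) ^ (i : ℕ) *
      ∏ α ∈ Finset.range (i : ℕ),
        ((1 + q ^ (4 * α + 1) * v) * (1 + q ^ (4 * α + 3) * v))⁻¹

/-- The intertwining matrix `C_L := G·C̃_L`. -/
noncomputable def CL (N : ℕ) (q u v u'' v'' h : ℂ) : Matrix (Fin N) (Fin N) ℂ :=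
  Gmat N q * CLtilde N q u v u'' v'' h

noncomputable def ff (q u v u'' v'' h : ℂ) (i j : ℕ) : ℂ :=
    q ^ (2 * ((j : ℤ) - (i : ℤ)) ^ 2 + 2 * (i : ℤ) ^ 2) *
      (u'' * v'' / (v * h)) ^ ((j : ℤ) - (i : ℤ)) *
      (u * v * v'' / h) ^ (i : ℕ) *
      ∏ α ∈ Finset.range (i : ℕ),
        ((1 + q ^ (4 * α + 1) * v) * (1 + q ^ (4 * α + 3) * v))⁻¹

lemma prod_one (N : ℕ) (hN : Odd N) (hNpos : 0 < N) (q v : ℂ) (hq : IsPrimitiveRoot q N) (c : ℕ) :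
    ∏ α ∈ Finset.range N, (1 + q ^ (4 * α + c) * v) = 1 + v ^ N := by
  have h4 : IsPrimitiveRoot (q ^ 4) N := by
    apply hq.pow_of_coprime
    have : Nat.Coprime 2 N := by simpa using hN
    exact Nat.Coprime.pow_left 2 this
  have key := h4.pow_sub_pow_eq_prod_sub_mul (x := (1:ℂ)) (y := -(q ^ c * v)) hNpos
  rw [hN.neg_pow, mul_pow, ← pow_mul, mul_comm c N, pow_mul, hq.pow_eq_one] at key
  simp only [one_pow, one_mul, sub_neg_eq_add] at key
  rw [key]
  refine Finset.prod_bij (fun α _ => (q ^ 4) ^ α) ?_ ?_ ?_ ?_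
  · intro α _
    rw [Polynomial.mem_nthRootsFinset hNpos, ← pow_mul, mul_comm, pow_mul, h4.pow_eq_one, one_pow]
  · intro a ha b hb hab
    exact h4.pow_inj (Finset.mem_range.1 ha) (Finset.mem_range.1 hb) hab
  · intro ζ hζ
    have : NeZero N := ⟨hNpos.ne'⟩
    obtain ⟨i, hi, h⟩ := h4.eq_pow_of_pow_eq_one ((Polynomial.mem_nthRootsFinset hNpos _).1 hζ)
    exact ⟨i, Finset.mem_range.2 hi, h⟩
  · intro α _
    ring

lemma ff_R1 (q u v u'' v'' h : ℂ) (hq : q ≠ 0) (hv : v ≠ 0) (hh : h ≠ 0)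
    (hu'' : u'' ≠ 0) (hv'' : v'' ≠ 0) (i j : ℕ) :
    v * q ^ (4 * i) * h * ff q u v u'' v'' h i (j + 1) =
      q ^ 2 * ff q u v u'' v'' h i j * u'' * v'' * q ^ (4 * j) := by
  unfold ff
  have hA : u'' * v'' / (v * h) ≠ 0 := by positivity
  have e1 : (2 * (((j + 1 : ℕ) : ℤ) - (i : ℤ)) ^ 2 + 2 * (i : ℤ) ^ 2) =
      (2 * ((j : ℤ) - (i : ℤ)) ^ 2 + 2 * (i : ℤ) ^ 2) + ((4 * j : ℕ) : ℤ) + ((2 : ℕ) : ℤ)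
        - ((4 * i : ℕ) : ℤ) := by
    push_cast; ring
  have e2 : (((j + 1 : ℕ) : ℤ) - (i : ℤ)) = ((j : ℤ) - (i : ℤ)) + 1 := by push_cast; ring
  rw [e1, e2, zpow_add_one₀ hA, zpow_sub₀ hq, zpow_add₀ hq, zpow_add₀ hq]
  simp only [zpow_natCast]
  generalize (u'' * v'' / (v * h)) ^ ((j : ℤ) - (i : ℤ)) = X
  generalize q ^ (2 * ((j : ℤ) - (i : ℤ)) ^ 2 + 2 * (i : ℤ) ^ 2) = Y
  generalize (∏ α ∈ Finset.range (i : ℕ),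
        ((1 + q ^ (4 * α + 1) * v) * (1 + q ^ (4 * α + 3) * v))⁻¹) = Z
  generalize (u * v * v'' / h) ^ (i : ℕ) = T
  field_simp

lemma ff_R2 (q u v u'' v'' h : ℂ) (hq : q ≠ 0) (hh : h ≠ 0) (i j : ℕ)
    (h1 : 1 + q ^ (4 * i + 1) * v ≠ 0) (h3 : 1 + q ^ (4 * i + 3) * v ≠ 0) :
    (1 + q ^ (4 * i + 1) * v) * (1 + q ^ (4 * i + 3) * v) * h * ff q u v u'' v'' h (i + 1) (j + 1) =
      q ^ (4 * i + 2) * v * u * v'' * ff q u v u'' v'' h i j := by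
  unfold ff
  have e1 : (2 * (((j + 1 : ℕ) : ℤ) - ((i + 1 : ℕ) : ℤ)) ^ 2 + 2 * ((i + 1 : ℕ) : ℤ) ^ 2) =
      (2 * ((j : ℤ) - (i : ℤ)) ^ 2 + 2 * (i : ℤ) ^ 2) + ((4 * i + 2 : ℕ) : ℤ) := by
    push_cast; ring
  have e2 : (((j + 1 : ℕ) : ℤ) - ((i + 1 : ℕ) : ℤ)) = ((j : ℤ) - (i : ℤ)) := by push_cast; ring
  rw [e1, e2, zpow_add₀ hq, Finset.prod_range_succ, pow_succ (u * v * v'' / h)]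
  simp only [zpow_natCast]
  generalize (u'' * v'' / (v * h)) ^ ((j : ℤ) - (i : ℤ)) = X
  generalize q ^ (2 * ((j : ℤ) - (i : ℤ)) ^ 2 + 2 * (i : ℤ) ^ 2) = Y
  generalize (∏ α ∈ Finset.range (i : ℕ),
        ((1 + q ^ (4 * α + 1) * v) * (1 + q ^ (4 * α + 3) * v))⁻¹) = Z
  generalize (u * v * v'' / h) ^ (i : ℕ) = T
  generalize q ^ (4 * i + 2) = S
  generalize 1 + q ^ (4 * i + 1) * v = A at *
  generalize 1 + q ^ (4 * i + 3) * v = B at *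
  field_simp

lemma ff_R3 (q u v u'' v'' h : ℂ) (hq : q ≠ 0) (hv : v ≠ 0) (hh : h ≠ 0)
    (hu'' : u'' ≠ 0) (hv'' : v'' ≠ 0) (i j : ℕ)
    (h1 : 1 + q ^ (4 * i + 1) * v ≠ 0) (h3 : 1 + q ^ (4 * i + 3) * v ≠ 0) :
    (1 + q ^ (4 * i + 1) * v) * (1 + q ^ (4 * i + 3) * v) * ff q u v u'' v'' h (i + 1) j
        * u'' * q ^ (4 * j) =
      q ^ (8 * i + 4) * v ^ 2 * u * ff q u v u'' v'' h i j := by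
  have r1 := ff_R1 q u v u'' v'' h hq hv hh hu'' hv'' (i + 1) j
  have r2 := ff_R2 q u v u'' v'' h hq hh i j h1 h3
  have : q ^ 2 * v'' ≠ 0 := by positivity
  apply mul_left_cancel₀ this
  have e : q ^ (4 * (i + 1)) * q ^ (4 * i + 2) = q ^ 2 * q ^ (8 * i + 4) := by ring
  linear_combination (- (1 + q ^ (4 * i + 1) * v) * (1 + q ^ (4 * i + 3) * v)) * r1 +
    v * q ^ (4 * (i + 1)) * r2 + v * v * u * v'' * ff q u v u'' v'' h i j * e

lemma ff_perj (N : ℕ) (q u v u'' v'' h : ℂ) (hq0 : q ≠ 0) (hq : q ^ N = 1)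
    (hX : (u'' * v'' / (v * h)) ^ N = 1) (hA : u'' * v'' / (v * h) ≠ 0) (i : ℕ) :
    ff q u v u'' v'' h i N = ff q u v u'' v'' h i 0 := by
  unfold ff
  have e1 : (2 * ((N : ℤ) - (i : ℤ)) ^ 2 + 2 * (i : ℤ) ^ 2) =
    (2 * (((0 : ℕ) : ℤ) - (i : ℤ)) ^ 2 + 2 * (i : ℤ) ^ 2) + (N : ℤ) * (2 * N - 4 * i) := by
    push_cast; ring
  have e2 : (N : ℤ) - (i : ℤ) = (((0 : ℕ) : ℤ) - (i : ℤ)) + N := by push_cast; ring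
  rw [e1, e2, zpow_add₀ hq0, zpow_add₀ hA, _root_.zpow_mul, zpow_natCast, zpow_natCast, hq, hX]
  simp

lemma ff_peri (N : ℕ) (hN : Odd N) (hNpos : 0 < N) (q u v u'' v'' h : ℂ) (hq : IsPrimitiveRoot q N)
    (hq0 : q ≠ 0) (hX : (u'' * v'' / (v * h)) ^ N = 1) (hA : u'' * v'' / (v * h) ≠ 0)
    (hv : 1 + v ^ N ≠ 0) (hY : (u * v * v'' / h) ^ N = (1 + v ^ N) ^ 2) (j : ℕ) :
    ff q u v u'' v'' h N j = ff q u v u'' v'' h 0 j := by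
  unfold ff
  have e1 : (2 * ((j : ℤ) - (N : ℤ)) ^ 2 + 2 * (N : ℤ) ^ 2) =
    (2 * ((j : ℤ) - ((0 : ℕ) : ℤ)) ^ 2 + 2 * ((0 : ℕ) : ℤ) ^ 2) + (N : ℤ) * (4 * N - 4 * j) := by
    push_cast; ring
  have e2 : (j : ℤ) - (N : ℤ) = ((j : ℤ) - ((0 : ℕ) : ℤ)) - N := by push_cast; ring
  rw [e1, e2, zpow_add₀ hq0, zpow_sub₀ hA, _root_.zpow_mul, zpow_natCast, zpow_natCast, hq.pow_eq_one, hX,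
    hY, Finset.prod_inv_distrib, Finset.prod_mul_distrib, prod_one N hN hNpos q v hq 1,
    prod_one N hN hNpos q v hq 3]
  simp
  field_simp

/-- The matrix `C_L` intertwines the representation `χ_{u″,v″,h}` with `χ_{u,v,h} ∘ ℒ`. -/
theorem stmt13 (N : ℕ) (hN : Odd N) (hNpos : 0 < N) (q : ℂ) (hq : IsPrimitiveRoot q N)
    (u v h u'' v'' : ℂ) (hu : u ≠ 0) (hv : v ≠ 0) (hh : h ≠ 0)
    (hu'' : u'' ≠ 0) (hv'' : v'' ≠ 0) (hvn : v ^ N ≠ -1)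
    (hu''N : u'' ^ N = u ^ N / (1 + (v ^ N)⁻¹) ^ 2)
    (hv''N : v'' ^ N = h ^ N * (1 + v ^ N) ^ 2 / (u ^ N * v ^ N)) :
    MU N q u * CL N q u v u'' v'' h
      = (1 + q • (MV N v)⁻¹) * (1 + q ^ 3 • (MV N v)⁻¹) * CL N q u v u'' v'' h * MU N q u'' ∧
    (1 + q • MV N v) * (1 + q ^ 3 • MV N v) * MW N q u v h * CL N q u v u'' v'' h
      = CL N q u v u'' v'' h * MV N v'' ∧
    MV N v * CL N q u v u'' v'' h * MW N q u'' v'' h = CL N q u v u'' v'' h := by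
  have hq0 : q ≠ 0 := hq.ne_zero hNpos.ne'
  have hqN := hq.pow_eq_one
  have hvN : 1 + v ^ N ≠ 0 := fun hc => hvn (by linear_combination hc)
  have hA : u'' * v'' / (v * h) ≠ 0 := by positivity
  have hX : (u'' * v'' / (v * h)) ^ N = 1 := by
    rw [div_pow, mul_pow, mul_pow, hu''N, hv''N]
    have : 1 + (v ^ N)⁻¹ = (1 + v ^ N) / v ^ N := by field_simp; ring
    rw [this]
    field_simp
  have hY : (u * v * v'' / h) ^ N = (1 + v ^ N) ^ 2 := by
    rw [div_pow, mul_pow, mul_pow, hv''N]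
    field_simp
  have hfac : ∀ c i : ℕ, 1 + q ^ (4 * i + c) * v ≠ 0 := by
    intro c i hc
    have h0 : q ^ (4 * i + c) * v = -1 := by linear_combination hc
    have h1 := congrArg (· ^ N) h0
    simp only [mul_pow, ← pow_mul] at h1
    rw [mul_comm _ N, pow_mul, hqN, one_pow, one_mul, hN.neg_one_pow] at h1
    exact hvn h1
  have : NeZero N := ⟨hNpos.ne'⟩
  obtain ⟨σ, hσ⟩ : ∃ σ : Equiv.Perm (Fin N), ∀ i, ((σ i : Fin N) : ℕ) = ((i : ℕ) + 1) % N :=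
    ⟨Equiv.addRight 1, fun i => by simp [Fin.val_add]⟩
  have hσ' : ∀ (g : ℕ → ℂ), g N = g 0 → ∀ i : Fin N, g (σ i) = g (i + 1) := by
    intro g hg i
    rw [hσ]
    rcases Nat.lt_or_ge ((i : ℕ) + 1) N with hlt | hge
    · rw [Nat.mod_eq_of_lt hlt]
    · have : (i : ℕ) + 1 = N := by omega
      rw [this, Nat.mod_self, hg]
  have hMV : ∀ (w : ℂ) i j, MV N w i j = if j = σ i then w else 0 := by
    intro w i j
    simp only [MV, Matrix.of_apply, Fin.ext_iff, hσ]
  have hVl : ∀ (w : ℂ) (X : Matrix (Fin N) (Fin N) ℂ) i j, (MV N w * X) i j = w * X (σ i) j := by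
    intro w X i j
    simp [Matrix.mul_apply, hMV]
  have hVr : ∀ (w : ℂ) (X : Matrix (Fin N) (Fin N) ℂ) i j, (X * MV N w) i (σ j) = X i j * w := by
    intro w X i j
    simp [Matrix.mul_apply, hMV]
  have hTl : ∀ (w : ℂ) (X : Matrix (Fin N) (Fin N) ℂ) i j,
      ((MV N w)ᵀ * X) (σ i) j = w * X i j := by
    intro w X i j
    simp [Matrix.mul_apply, hMV]
  have hTr : ∀ (w : ℂ) (X : Matrix (Fin N) (Fin N) ℂ) i j,
      (X * (MV N w)ᵀ) i j = X i (σ j) * w := by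
    intro w X i j
    simp [Matrix.mul_apply, hMV]
  have hq4 : ∀ i : Fin N, q ^ (4 * (σ i : ℕ)) = q ^ (4 * ((i : ℕ) + 1)) :=
    hσ' (fun n => q ^ (4 * n)) (by simp [mul_comm 4 N, pow_mul, hqN])
  have hG1 : ∀ w, MV N w * Gmat N q = Gmat N q * MU N q w := by
    intro w
    ext i j
    rw [hVl, MU, Matrix.mul_diagonal]
    simp only [Gmat, Matrix.of_apply]
    rw [pow_mul, hq4, ← pow_mul]
    ring
  have hG2 : ∀ w, MU N q w * Gmat N q = Gmat N q * (MV N w)ᵀ := by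
    intro w
    ext i j
    rw [hTr, MU, Matrix.diagonal_mul]
    simp only [Gmat, Matrix.of_apply]
    rw [mul_right_comm 4 (i : ℕ) (σ j : ℕ), pow_mul q (4 * (σ j : ℕ)), hq4, ← pow_mul]
    ring
  have hTinv : ∀ w : ℂ, w ≠ 0 → (MV N w)ᵀ * MV N w⁻¹ = 1 := by
    intro w hw
    ext i j
    obtain ⟨i, rfl⟩ := σ.surjective i
    rw [hTl, hMV, Matrix.one_apply]
    by_cases hij : j = σ i
    · simp [hij, hw]
    · simp [hij, Ne.symm hij]
  have hUinv : ∀ w : ℂ, w ≠ 0 →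
      MU N q w * Matrix.diagonal (fun i : Fin N => (w * q ^ (4 * (i : ℕ)))⁻¹) = 1 := by
    intro w hw
    rw [MU, Matrix.diagonal_mul_diagonal, ← Matrix.diagonal_one]
    congr 1
    ext i
    exact mul_inv_cancel₀ (by positivity)
  have hUdet : ∀ w : ℂ, w ≠ 0 → IsUnit (MU N q w).det := fun w hw =>
    (Matrix.isUnit_iff_isUnit_det _).1 (IsUnit.of_mul_eq_one _ (hUinv w hw))
  have hTdet : ∀ w : ℂ, w ≠ 0 → IsUnit (MV N w)ᵀ.det := fun w hw =>
    (Matrix.isUnit_iff_isUnit_det _).1 (IsUnit.of_mul_eq_one _ (hTinv w hw))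
  have hVdet : ∀ w : ℂ, w ≠ 0 → IsUnit (MV N w).det := fun w hw => by
    rw [← Matrix.det_transpose]; exact hTdet w hw
  have hconj : ∀ A B X : Matrix (Fin N) (Fin N) ℂ, IsUnit A.det → IsUnit B.det →
      A * X = X * B → A⁻¹ * X = X * B⁻¹ := by
    intro A B X hA hB hAB
    calc A⁻¹ * X = A⁻¹ * (X * B) * B⁻¹ := by
          rw [Matrix.mul_assoc, Matrix.mul_assoc, Matrix.mul_nonsing_inv _ hB, Matrix.mul_one]
      _ = X * B⁻¹ := by
          rw [← hAB, ← Matrix.mul_assoc, Matrix.nonsing_inv_mul _ hA, Matrix.one_mul]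
  have hquad : ∀ (a b : ℂ) (A B X : Matrix (Fin N) (Fin N) ℂ), A * X = X * B →
      (1 + a • A) * (1 + b • A) * X = X * ((1 + a • B) * (1 + b • B)) := by
    intro a b A B X hAB
    have h1 : ∀ c : ℂ, (1 + c • A) * X = X * (1 + c • B) := by
      intro c
      rw [Matrix.add_mul, Matrix.mul_add, Matrix.smul_mul, Matrix.mul_smul, hAB, Matrix.one_mul,
        Matrix.mul_one]
    rw [Matrix.mul_assoc, h1, ← Matrix.mul_assoc, h1, Matrix.mul_assoc]
  have hC : ∀ i j, CLtilde N q u v u'' v'' h i j = ff q u v u'' v'' h i j := fun i j => rfl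
  have hCi : ∀ (i : Fin N) (j : ℕ),
      ff q u v u'' v'' h (σ i) j = ff q u v u'' v'' h (i + 1) j := fun i j =>
    hσ' (fun n => ff q u v u'' v'' h n j) (ff_peri N hN hNpos q u v u'' v'' h hq hq0 hX hA hvN hY j) i
  have hCj : ∀ (i : ℕ) (j : Fin N),
      ff q u v u'' v'' h i (σ j) = ff q u v u'' v'' h i (j + 1) := fun i j =>
    hσ' (fun n => ff q u v u'' v'' h i n) (ff_perj N q u v u'' v'' h hq0 hqN hX hA i) j
  have hPinv : (MU N q v)⁻¹ = Matrix.diagonal (fun i : Fin N => (v * q ^ (4 * (i : ℕ)))⁻¹) :=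
    Matrix.inv_eq_right_inv (hUinv v hv)
  have hTi : ((MV N u)ᵀ)⁻¹ = MV N u⁻¹ := Matrix.inv_eq_right_inv (hTinv u hu)
  have hdq : ∀ (a b : ℂ) (d : Fin N → ℂ), (1 + a • Matrix.diagonal d) * (1 + b • Matrix.diagonal d)
      = Matrix.diagonal (fun i => (1 + a * d i) * (1 + b * d i)) := by
    intro a b d
    rw [← Matrix.diagonal_one, ← Matrix.diagonal_smul, ← Matrix.diagonal_smul,
      Matrix.diagonal_add, Matrix.diagonal_add, Matrix.diagonal_mul_diagonal]
    rfl
  refine ⟨?_, ?_, ?_⟩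
  · rw [CL, ← Matrix.mul_assoc, ← Matrix.mul_assoc, hG2,
      hquad q (q ^ 3) _ _ _ (hconj _ _ _ (hVdet v hv) (hUdet v hv) (hG1 v)), Matrix.mul_assoc,
      Matrix.mul_assoc, Matrix.mul_assoc]
    congr 1
    rw [hPinv, hdq]
    ext i j
    obtain ⟨i, rfl⟩ := σ.surjective i
    rw [hTl, ← Matrix.mul_assoc, MU, Matrix.mul_diagonal, Matrix.diagonal_mul, hC, hC, hCi, hq4]
    have r3 := ff_R3 q u v u'' v'' h hq0 hv hh hu'' hv'' i j (hfac 1 i) (hfac 3 i)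
    have e1 : 1 + q * (v * q ^ (4 * ((i : ℕ) + 1)))⁻¹
        = (1 + q ^ (4 * (i : ℕ) + 3) * v) / (q ^ (4 * (i : ℕ) + 3) * v) := by
      field_simp
      ring
    have e2 : 1 + q ^ 3 * (v * q ^ (4 * ((i : ℕ) + 1)))⁻¹
        = (1 + q ^ (4 * (i : ℕ) + 1) * v) / (q ^ (4 * (i : ℕ) + 1) * v) := by
      field_simp
      ring
    rw [e1, e2]
    have e3 : q ^ (4 * (i : ℕ) + 3) * v * (q ^ (4 * (i : ℕ) + 1) * v)
      = q ^ (8 * (i : ℕ) + 4) * v ^ 2 := by ring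
    rw [div_mul_div_comm, e3, div_mul_eq_mul_div, div_mul_eq_mul_div, eq_div_iff (by positivity)]
    linear_combination -r3
  · have hW : (MU N q u * MV N v)⁻¹ * Gmat N q = Gmat N q * ((MV N u)ᵀ * MU N q v)⁻¹ := by
      apply hconj
      · rw [Matrix.det_mul]; exact (hUdet u hu).mul (hVdet v hv)
      · rw [Matrix.det_mul]; exact (hTdet u hu).mul (hUdet v hv)
      · rw [Matrix.mul_assoc, hG1, ← Matrix.mul_assoc, hG2, Matrix.mul_assoc]
    have hW' : MW N q u v h * Gmat N q
        = Gmat N q * (((q ^ 2)⁻¹ * h) • ((MV N u)ᵀ * MU N q v)⁻¹) := by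
      rw [MW, Matrix.smul_mul, hW, ← Matrix.mul_smul]
    have hQ := hquad q (q ^ 3) _ _ _ (hG1 v)
    rw [CL, Matrix.mul_assoc _ (MW N q u v h), ← Matrix.mul_assoc (MW N q u v h), hW',
      Matrix.mul_assoc (Gmat N q), ← Matrix.mul_assoc _ (Gmat N q), hQ,
      Matrix.mul_assoc (Gmat N q), Matrix.mul_assoc (Gmat N q)]
    congr 1
    rw [Matrix.mul_inv_rev, hPinv, hTi, MU, hdq, Matrix.smul_mul, Matrix.mul_smul]
    ext i j
    obtain ⟨j, rfl⟩ := σ.surjective j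
    rw [Matrix.smul_apply, Matrix.diagonal_mul, Matrix.mul_assoc, Matrix.diagonal_mul, hVl, hVr,
      hC, hC, hCi, hCj, smul_eq_mul]
    have r2 := ff_R2 q u v u'' v'' h hq0 hh i j (hfac 1 i) (hfac 3 i)
    have e1 : 1 + q * (v * q ^ (4 * (i : ℕ))) = 1 + q ^ (4 * (i : ℕ) + 1) * v := by ring
    have e2 : 1 + q ^ 3 * (v * q ^ (4 * (i : ℕ))) = 1 + q ^ (4 * (i : ℕ) + 3) * v := by ring
    rw [e1, e2]
    have hne : q ^ (4 * (i : ℕ) + 2) * v * u ≠ 0 := by positivity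
    apply mul_left_cancel₀ hne
    have e3 : q ^ (4 * (i : ℕ) + 2) * v * u * ((q ^ 2)⁻¹ * (v * q ^ (4 * (i : ℕ)))⁻¹ * u⁻¹) = 1 := by
      field_simp
      ring
    linear_combination r2 + (1 + q ^ (4 * (i : ℕ) + 1) * v) * (1 + q ^ (4 * (i : ℕ) + 3) * v) * h *
      ff q u v u'' v'' h (i + 1) (j + 1) * e3
  · have hdet : IsUnit (MU N q u'' * MV N v'').det := by
      rw [Matrix.det_mul]; exact (hUdet u'' hu'').mul (hVdet v'' hv'')
    have key : ((q ^ 2)⁻¹ * h) • (MV N v * CL N q u v u'' v'' h)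
        = CL N q u v u'' v'' h * (MU N q u'' * MV N v'') := by
      rw [CL, ← Matrix.mul_assoc, hG1, Matrix.mul_assoc, Matrix.mul_assoc, ← Matrix.mul_smul]
      congr 1
      ext i j
      obtain ⟨j, rfl⟩ := σ.surjective j
      rw [← Matrix.mul_assoc, hVr, MU, MU, Matrix.mul_diagonal, Matrix.smul_apply,
        Matrix.diagonal_mul, hC, hC, hCj, smul_eq_mul]
      have r1 := ff_R1 q u v u'' v'' h hq0 hv hh hu'' hv'' i j
      have hne : q ^ 2 ≠ 0 := by positivity
      apply mul_left_cancel₀ hne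
      have e : q ^ 2 * (q ^ 2)⁻¹ = 1 := mul_inv_cancel₀ hne
      linear_combination r1 + h * v * q ^ (4 * (i : ℕ)) * ff q u v u'' v'' h i (j + 1) * e
    rw [MW, Matrix.mul_smul, ← Matrix.smul_mul, key, Matrix.mul_assoc,
      Matrix.mul_nonsing_inv _ hdet, Matrix.mul_one]
end
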